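/- Define A(m) := ∑_{i=1}^{m-1} 2^{m-1-i}·(2^{-(2^i - 2)} - 2^{-(2^{i+1} - 2)}) + 2^{m-1} - (2^m - 1)·η for integers m ≥ 1. Then A(m) converges to η as m → ∞; i.e., the dual values α_{(2^m - 1)} approach η as the primal variable 1 - 2^{-(2^m - 1)} approaches 1. -/

import Mathlib

open Finset

/-- `η := 1 - ∑_{i=1}^∞ 2^{-(2^i + i - 1)}` (reindexed by `i ↦ i + 1`, noting
`2^(i+1) + (i+1) - 1 = 2^(i+1) + i`). -/
noncomputable def eta : ℝ := 1 - ∑' i : ℕ, (1 / 2 : ℝ) ^ (2 ^ (i + 1) + i)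

/-- `A m = α_{(2^m - 1)}`: the closed form
`∑_{i=1}^{m-1} 2^{m-1-i}·(2^{-(2^i-2)} - 2^{-(2^{i+1}-2)}) + 2^{m-1} - (2^m - 1)·η`
(note `2·(2^i - 2) + 2 = 2^{i+1} - 2`). -/
noncomputable def A (m : ℕ) : ℝ :=
  (∑ i ∈ Finset.Icc 1 (m - 1),
      (2 : ℝ) ^ (m - 1 - i) *
        ((1 / 2 : ℝ) ^ (2 ^ i - 2) - (1 / 2 : ℝ) ^ (2 ^ (i + 1) - 2)))
    + 2 ^ (m - 1) - ((2 : ℝ) ^ m - 1) * eta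

/-- The summand of the series defining `eta`. -/
noncomputable def etaTerm (i : ℕ) : ℝ := (1 / 2 : ℝ) ^ (2 ^ (i + 1) + i)

theorem etaTerm_add_le (n k : ℕ) :
    etaTerm (k + n) ≤ (1 / 2 : ℝ) ^ (2 ^ (n + 1) + n) * (1 / 2 : ℝ) ^ k := by
  rw [etaTerm, ← pow_add]
  apply pow_le_pow_of_le_one (by norm_num) (by norm_num)
  have : 2 ^ (n + 1) ≤ 2 ^ (k + n + 1) := Nat.pow_le_pow_right (by norm_num) (by omega)
  omega

theorem etaTerm_nonneg (i : ℕ) : 0 ≤ etaTerm i := by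
  unfold etaTerm
  positivity

theorem summable_etaTerm : Summable etaTerm :=
  Summable.of_nonneg_of_le etaTerm_nonneg (fun k => etaTerm_add_le 0 k)
    (summable_geometric_two.mul_left _)

theorem two_pow_mul_etaTerm (n : ℕ) :
    (2 : ℝ) ^ (n + 2) * etaTerm n = (1 / 2 : ℝ) ^ (2 ^ (n + 1) - 2) := by
  obtain ⟨c, hc⟩ := Nat.exists_eq_add_of_le
    (show 2 ≤ 2 ^ (n + 1) from Nat.le_self_pow (by omega) 2)
  rw [etaTerm, hc, show 2 + c + n = (n + 2) + c by ring, Nat.add_sub_cancel_left, pow_add (1 / 2),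
    ← mul_assoc, ← mul_pow]
  norm_num

theorem sum_Icc_add_two_pow (n : ℕ) :
    (∑ i ∈ Finset.Icc 1 n, (2 : ℝ) ^ (n - i) *
        ((1 / 2 : ℝ) ^ (2 ^ i - 2) - (1 / 2 : ℝ) ^ (2 ^ (i + 1) - 2))) + 2 ^ n =
      2 ^ (n + 1) * (1 - ∑ i ∈ Finset.range n, etaTerm i) -
        (1 / 2 : ℝ) ^ (2 ^ (n + 1) - 2) := by
  induction n with
  | zero => norm_num
  | succ n ih =>
    have hdouble : ∑ i ∈ Finset.Icc 1 n, (2 : ℝ) ^ (n + 1 - i) *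
          ((1 / 2 : ℝ) ^ (2 ^ i - 2) - (1 / 2 : ℝ) ^ (2 ^ (i + 1) - 2)) =
        2 * ∑ i ∈ Finset.Icc 1 n, (2 : ℝ) ^ (n - i) *
          ((1 / 2 : ℝ) ^ (2 ^ i - 2) - (1 / 2 : ℝ) ^ (2 ^ (i + 1) - 2)) := by
      rw [Finset.mul_sum]
      refine Finset.sum_congr rfl fun i hi => ?_
      rw [Nat.succ_sub (Finset.mem_Icc.1 hi).2, pow_succ]
      ring
    rw [Finset.sum_Icc_succ_top (by omega), hdouble, Finset.sum_range_succ, Nat.sub_self]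
    linear_combination 2 * ih + two_pow_mul_etaTerm n

theorem A_succ (n : ℕ) :
    A (n + 1) = eta - (1 / 2 : ℝ) ^ (2 ^ (n + 1) - 2) +
      2 ^ (n + 1) * ∑' k, etaTerm (k + n) := by
  have heta : eta = 1 - ∑' i, etaTerm i := rfl
  have hA := sum_Icc_add_two_pow n
  have hsplit := summable_etaTerm.sum_add_tsum_nat_add n
  rw [A, Nat.add_sub_cancel]
  linear_combination hA - 2 ^ (n + 1) * heta - 2 ^ (n + 1) * hsplit

theorem two_pow_mul_tsum_etaTerm_le (n : ℕ) :
    2 ^ (n + 1) * ∑' k, etaTerm (k + n) ≤ 4 * (1 / 2 : ℝ) ^ (2 ^ (n + 1)) := by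
  have h : ∑' k, etaTerm (k + n) ≤ (1 / 2 : ℝ) ^ (2 ^ (n + 1) + n) * 2 := by
    refine le_of_le_of_eq ?_ (congrArg _ tsum_geometric_two)
    rw [← tsum_mul_left]
    exact ((summable_nat_add_iff n).2 summable_etaTerm).tsum_le_tsum (etaTerm_add_le n)
      (summable_geometric_two.mul_left _)
  calc 2 ^ (n + 1) * ∑' k, etaTerm (k + n)
      ≤ 2 ^ (n + 1) * ((1 / 2 : ℝ) ^ (2 ^ (n + 1) + n) * 2) := by gcongr
    _ = 4 * (1 / 2 : ℝ) ^ (2 ^ (n + 1)) * (2 * (1 / 2 : ℝ)) ^ n := by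
      rw [mul_pow, pow_add, pow_succ]
      ring
    _ = 4 * (1 / 2 : ℝ) ^ (2 ^ (n + 1)) := by norm_num

/-- The dual values `A m = α_{(2^m - 1)}` converge to `η` as `m → ∞`. -/
theorem A_tendsto_eta :
    Filter.Tendsto (fun m : ℕ => A m) Filter.atTop (nhds eta) := by
  have hexp : Filter.Tendsto (fun n : ℕ => 2 ^ (n + 1)) Filter.atTop Filter.atTop :=
    (tendsto_pow_atTop_atTop_of_one_lt one_lt_two).comp (Filter.tendsto_add_atTop_nat 1)
  have hhalf : Filter.Tendsto (fun n : ℕ => (1 / 2 : ℝ) ^ n) Filter.atTop (nhds 0) :=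
    tendsto_pow_atTop_nhds_zero_of_lt_one (by norm_num) (by norm_num)
  have hb : Filter.Tendsto (fun n : ℕ => (1 / 2 : ℝ) ^ (2 ^ (n + 1) - 2))
      Filter.atTop (nhds 0) :=
    hhalf.comp ((Filter.tendsto_sub_atTop_nat 2).comp hexp)
  have htail : Filter.Tendsto (fun n : ℕ => 2 ^ (n + 1) * ∑' k, etaTerm (k + n))
      Filter.atTop (nhds 0) :=
    squeeze_zero (fun n => mul_nonneg (by positivity) (tsum_nonneg fun k => etaTerm_nonneg _))
      two_pow_mul_tsum_etaTerm_le (by simpa using (hhalf.comp hexp).const_mul 4)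
  rw [← Filter.tendsto_add_atTop_iff_nat 1]
  simpa only [A_succ, sub_zero, add_zero] using (hb.const_sub eta).add htail
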